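/- Let 0 < α < 1, t > 0, and x ∈ ℝ² with x ≠ 0, and set c = |x|²/(4t). Then the subordinated two-dimensional Green function satisfies (t^α / (4π²)) ∫_0^∞ (τ^{α-2} sin(απ)) / (t^{2α} + 2 t^α τ^α cos(απ) + τ^{2α}) · e^{-|x|²/(4τ)} dτ = (1/(4πt)) · c^{α-1} · ∑_{k=0}^∞ (-c^α)^k / Γ(αk + α). -/

import Mathlib

open Real MeasureTheory

open Set Filter Topology

/-- The integrand `e^{c z} g dz` of a Hankel-type contour integral, in the logarithmic coordinate
`z = e^w`. -/
noncomputable def hankelKernel (c : ℝ) (g : ℂ → ℂ) (w : ℂ) : ℂ :=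
  Complex.exp (c * Complex.exp w) * Complex.exp w * g w

/-- The part of the Hankel contour integral over the circle `|z| = e^L`. -/
noncomputable def hankelArc (c : ℝ) (g : ℂ → ℂ) (L : ℝ) : ℂ :=
  Complex.I * ∫ φ in (-π)..π, hankelKernel c g (L + φ * Complex.I)

/-- The jump of the integrand across the negative real axis, at `|z| = e^u`. -/
noncomputable def hankelJump (c : ℝ) (g : ℂ → ℂ) (u : ℝ) : ℂ :=
  hankelKernel c g (u + π * Complex.I) - hankelKernel c g (u + (-π : ℝ) * Complex.I)

/-- The Hankel contour integral, with the contour running along the circle `|z| = e` and both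
sides of the cut `z < -e`. -/
noncomputable def hankelIntegral (c : ℝ) (g : ℂ → ℂ) : ℂ :=
  hankelArc c g 1 + ∫ u in Ioi (1 : ℝ), hankelJump c g u

/-- The closed strip `|Im w| ≤ π`, image of the cut plane under the logarithm. -/
def logStrip : Set ℂ := {w | |w.im| ≤ π}

lemma add_mul_I_mem_logStrip {u φ : ℝ} (h : |φ| ≤ π) : (u + φ * Complex.I : ℂ) ∈ logStrip := by
  simpa [logStrip] using h

lemma exp_add_pi_mul_I (u : ℝ) : Complex.exp (u + π * Complex.I) = -rexp u := by
  rw [Complex.exp_add, Complex.exp_pi_mul_I]; push_cast; ring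

lemma exp_add_neg_pi_mul_I (u : ℝ) : Complex.exp (u + (-π : ℝ) * Complex.I) = -rexp u := by
  have : (u + (-π : ℝ) * Complex.I : ℂ) = u - π * Complex.I := by push_cast; ring
  rw [this, Complex.exp_sub, Complex.exp_pi_mul_I]; push_cast; ring

lemma hankelJump_eq (c : ℝ) (g : ℂ → ℂ) (u : ℝ) :
    hankelJump c g u = (rexp (-(c * rexp u)) * rexp u : ℝ) *
      (g (u + (-π : ℝ) * Complex.I) - g (u + π * Complex.I)) := by
  simp only [hankelJump, hankelKernel, exp_add_pi_mul_I, exp_add_neg_pi_mul_I]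
  push_cast
  ring_nf

lemma differentiableOn_hankelKernel {c : ℝ} {g : ℂ → ℂ} (hg : DifferentiableOn ℂ g logStrip) :
    DifferentiableOn ℂ (hankelKernel c g) logStrip := by
  unfold hankelKernel
  exact DifferentiableOn.mul (by fun_prop) hg

lemma continuous_hankelKernel_horizontal {c : ℝ} {g : ℂ → ℂ} (hg : DifferentiableOn ℂ g logStrip)
    {φ : ℝ} (h : |φ| ≤ π) : Continuous fun u : ℝ => hankelKernel c g (u + φ * Complex.I) :=
  (differentiableOn_hankelKernel hg).continuousOn.comp_continuous (by fun_prop)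
    fun _ => add_mul_I_mem_logStrip h

lemma continuousOn_hankelKernel_vertical {c : ℝ} {g : ℂ → ℂ} (hg : DifferentiableOn ℂ g logStrip)
    (L : ℝ) : ContinuousOn (fun φ : ℝ => hankelKernel c g (L + φ * Complex.I)) (uIcc (-π) π) :=
  (differentiableOn_hankelKernel hg).continuousOn.comp (by fun_prop) fun φ hφ => by
    rw [uIcc_of_le (by linarith [pi_pos])] at hφ
    exact add_mul_I_mem_logStrip (abs_le.2 hφ)

lemma aestronglyMeasurable_hankelKernel_vertical {c : ℝ} {g : ℂ → ℂ}
    (hg : DifferentiableOn ℂ g logStrip) (L : ℝ) :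
    AEStronglyMeasurable (fun φ : ℝ => hankelKernel c g (L + φ * Complex.I))
      (volume.restrict (uIoc (-π) π)) :=
  ((continuousOn_hankelKernel_vertical hg L).mono uIoc_subset_uIcc).aestronglyMeasurable
    measurableSet_uIoc

lemma continuous_hankelJump {c : ℝ} {g : ℂ → ℂ} (hg : DifferentiableOn ℂ g logStrip) :
    Continuous (hankelJump c g) :=
  (continuous_hankelKernel_horizontal hg (abs_of_pos pi_pos).le).sub
    (continuous_hankelKernel_horizontal hg (by rw [abs_neg, abs_of_pos pi_pos]))

lemma hankelArc_eq_add_integral {c : ℝ} {g : ℂ → ℂ} (hg : DifferentiableOn ℂ g logStrip)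
    (L₁ L₂ : ℝ) :
    hankelArc c g L₂ = hankelArc c g L₁ + ∫ u in L₁..L₂, hankelJump c g u := by
  have H := Complex.integral_boundary_rect_eq_zero_of_differentiableOn (hankelKernel c g)
    ⟨L₁, -π⟩ ⟨L₂, π⟩ ((differentiableOn_hankelKernel hg).mono fun w hw => by
      have := hw.2
      simp only [mem_preimage] at this
      rw [uIcc_of_le (by linarith [pi_pos])] at this
      exact abs_le.2 this)
  simp only [smul_eq_mul] at H
  have hs : ∫ u in L₁..L₂, hankelJump c g u =
      (∫ u in L₁..L₂, hankelKernel c g (u + π * Complex.I)) -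
        ∫ u in L₁..L₂, hankelKernel c g (u + (-π : ℝ) * Complex.I) :=
    intervalIntegral.integral_sub
      ((continuous_hankelKernel_horizontal hg (abs_of_pos pi_pos).le).intervalIntegrable _ _)
      ((continuous_hankelKernel_horizontal hg
        (by rw [abs_neg, abs_of_pos pi_pos])).intervalIntegrable _ _)
  rw [hs, hankelArc, hankelArc]
  linear_combination H

lemma tendsto_hankelArc_atTop {c : ℝ} {g : ℂ → ℂ} (hg : DifferentiableOn ℂ g logStrip)
    (hi : IntegrableOn (hankelJump c g) (Ioi 1)) :
    Tendsto (hankelArc c g) atTop (𝓝 (hankelIntegral c g)) := by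
  have := (intervalIntegral_tendsto_integral_Ioi 1 hi tendsto_id).const_add (hankelArc c g 1)
  exact this.congr fun L => (hankelArc_eq_add_integral hg 1 L).symm

lemma hankelIntegral_eq_of_tendsto_atBot {c : ℝ} {g : ℂ → ℂ}
    (hg : DifferentiableOn ℂ g logStrip) (hi : Integrable (hankelJump c g)) {l : ℂ}
    (hl : Tendsto (hankelArc c g) atBot (𝓝 l)) :
    hankelIntegral c g = l + ∫ u, hankelJump c g u := by
  have h1 := (intervalIntegral_tendsto_integral_Iic 1 hi.integrableOn tendsto_id).const_sub
    (hankelArc c g 1)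
  have h2 := tendsto_nhds_unique hl (h1.congr fun L => by
    rw [hankelArc_eq_add_integral hg L 1]; simp)
  have h3 := intervalIntegral.integral_Iic_add_Ioi (b := (1 : ℝ)) hi.integrableOn hi.integrableOn
  rw [hankelIntegral, h2, ← h3]
  ring

/-- Limit of the arc integrals over small circles. -/
lemma tendsto_hankelArc_atBot {c : ℝ} {g : ℂ → ℂ} (hg : DifferentiableOn ℂ g logStrip) {M : ℝ}
    {l : ℂ}
    (hM : ∀ᶠ L : ℝ in atBot, ∀ φ : ℝ,
      ‖Complex.exp (L + φ * Complex.I) * g (L + φ * Complex.I)‖ ≤ M)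
    (hl : ∀ φ : ℝ, Tendsto (fun L : ℝ =>
      Complex.exp (L + φ * Complex.I) * g (L + φ * Complex.I)) atBot (𝓝 l)) :
    Tendsto (hankelArc c g) atBot (𝓝 (2 * π * Complex.I * l)) := by
  have hexp (φ : ℝ) : Tendsto (fun L : ℝ => Complex.exp (L + φ * Complex.I)) atBot (𝓝 0) := by
    rw [tendsto_zero_iff_norm_tendsto_zero]
    simpa [Complex.norm_exp] using tendsto_exp_atBot
  have key : Tendsto (fun L : ℝ => ∫ φ in (-π)..π, hankelKernel c g (L + φ * Complex.I)) atBot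
      (𝓝 (∫ _φ in (-π)..π, l)) := by
    refine intervalIntegral.tendsto_integral_filter_of_dominated_convergence (fun _ => rexp |c| * M)
      (Eventually.of_forall fun L => aestronglyMeasurable_hankelKernel_vertical hg L) ?_
      (by simp) ?_
    · filter_upwards [hM, eventually_le_atBot 0] with L h1 h2
      refine Eventually.of_forall fun φ _ => ?_
      rw [hankelKernel, mul_assoc, norm_mul]
      refine mul_le_mul ?_ (h1 φ) (norm_nonneg _) (exp_pos _).le
      refine (Complex.norm_exp_le_exp_norm _).trans (exp_le_exp.2 ?_)
      rw [norm_mul, Complex.norm_exp]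
      simpa using mul_le_mul_of_nonneg_left (exp_le_one_iff.2 h2) (abs_nonneg c)
    · refine Eventually.of_forall fun φ _ => ?_
      have h1 := ((hexp φ).const_mul (c : ℂ)).cexp.mul (hl φ)
      simpa [hankelKernel, mul_assoc] using h1
  have := key.const_mul Complex.I
  rw [intervalIntegral.integral_const] at this
  have e : 2 * π * Complex.I * l = Complex.I * (π - -π) • l := by
    rw [Complex.real_smul]
    push_cast
    ring
  rw [e]
  exact this

lemma Ioi_zero_eq_image_mul_exp {t k : ℝ} (ht : 0 < t) (hk : k ≠ 0) :
    Ioi (0 : ℝ) = (fun u => t * rexp (k * u)) '' univ := by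
  ext y
  simp only [mem_Ioi, image_univ, mem_range]
  constructor
  · intro hy
    refine ⟨log (y / t) / k, ?_⟩
    rw [mul_div_cancel₀ _ hk, exp_log (by positivity)]
    field_simp
  · rintro ⟨u, rfl⟩
    positivity

lemma hasDerivAt_mul_exp (t k u : ℝ) :
    HasDerivAt (fun u => t * rexp (k * u)) (k * (t * rexp (k * u))) u := by
  convert! (((hasDerivAt_id u).const_mul k).exp.const_mul t) using 1
  simp only [id]
  ring

lemma injective_mul_exp {t k : ℝ} (ht : 0 < t) (hk : k ≠ 0) :
    Function.Injective fun u => t * rexp (k * u) := fun _ _ h =>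
  mul_left_cancel₀ hk (exp_injective (mul_left_cancel₀ ht.ne' h))

lemma integral_Ioi_eq_integral_mul_exp {t k : ℝ} (ht : 0 < t) (hk : k ≠ 0) (f : ℝ → ℝ) :
    ∫ y in Ioi (0 : ℝ), f y = ∫ u, |k * (t * rexp (k * u))| * f (t * rexp (k * u)) := by
  rw [Ioi_zero_eq_image_mul_exp ht hk, integral_image_eq_integral_abs_deriv_smul
    MeasurableSet.univ (fun u _ => (hasDerivAt_mul_exp t k u).hasDerivWithinAt)
    (injective_mul_exp ht hk).injOn, Measure.restrict_univ]
  rfl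

lemma integral_exp_neg_mul_exp {c p : ℝ} (hc : 0 < c) (hp : 0 < p) :
    ∫ u, rexp (-(c * rexp u)) * rexp (p * u) = (1 / c) ^ p * Real.Gamma p := by
  rw [← integral_rpow_mul_exp_neg_mul_Ioi hp hc,
    integral_Ioi_eq_integral_mul_exp one_pos one_ne_zero]
  refine integral_congr_ae (Eventually.of_forall fun u => ?_)
  simp only [one_mul, abs_exp, ← exp_mul]
  have h : rexp (p * u) = rexp u * rexp (u * (p - 1)) := by rw [← exp_add]; ring_nf
  rw [h]
  ring

lemma integrable_exp_neg_mul_exp {c p : ℝ} (hc : 0 < c) (hp : 0 < p) :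
    Integrable fun u => rexp (-(c * rexp u)) * rexp (p * u) := by
  refine .of_integral_ne_zero ?_
  rw [integral_exp_neg_mul_exp hc hp]
  have := Gamma_pos_of_pos hp
  positivity

/-- The power `z^{-s}` in the logarithmic coordinate. -/
noncomputable def expPow (s : ℝ) (w : ℂ) : ℂ := Complex.exp (-(s * w))

lemma differentiableOn_expPow (s : ℝ) : DifferentiableOn ℂ (expPow s) logStrip := by
  unfold expPow; fun_prop

lemma hankelJump_expPow (c s u : ℝ) :
    hankelJump c (expPow s) u =
      2 * Complex.I * sin (π * s) * (rexp (-(c * rexp u)) * rexp ((1 - s) * u) : ℝ) := by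
  have h1 : -(s * (u + (-π : ℝ) * Complex.I) : ℂ) = (-(s * u) : ℝ) + (π * s : ℝ) * Complex.I := by
    push_cast; ring
  have h2 : -(s * (u + π * Complex.I) : ℂ) = (-(s * u) : ℝ) + (-(π * s) : ℝ) * Complex.I := by
    push_cast; ring
  have h3 : rexp ((1 - s) * u) = rexp u * rexp (-(s * u)) := by rw [← exp_add]; ring_nf
  rw [hankelJump_eq, expPow, expPow, h1, h2, Complex.exp_add, Complex.exp_add,
    Complex.exp_mul_I, Complex.exp_mul_I, h3]
  push_cast
  rw [Complex.cos_neg, Complex.sin_neg]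
  ring

lemma integrable_hankelJump_expPow {c s : ℝ} (hc : 0 < c) (hs : s < 1) :
    Integrable (hankelJump c (expPow s)) := by
  simp only [funext (hankelJump_expPow c s)]
  exact (integrable_exp_neg_mul_exp hc (sub_pos.2 hs)).ofReal.const_mul _

lemma integrableOn_hankelJump_expPow {c s : ℝ} (hc : 0 < c) (hs : 0 ≤ s) :
    IntegrableOn (hankelJump c (expPow s)) (Ioi 1) := by
  refine ((integrable_exp_neg_mul_exp hc one_pos).integrableOn.const_mul 2).mono'
    (continuous_hankelJump (differentiableOn_expPow s)).aestronglyMeasurable ?_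
  refine (ae_restrict_mem measurableSet_Ioi).mono fun u hu => ?_
  rw [hankelJump_expPow, norm_mul, norm_mul, Complex.norm_real, Complex.norm_real,
    Real.norm_of_nonneg (mul_pos (exp_pos _) (exp_pos _)).le]
  have h1 : ‖2 * Complex.I‖ * ‖sin (π * s)‖ ≤ 2 := by
    simpa using abs_sin_le_one (π * s)
  refine mul_le_mul h1 (mul_le_mul_of_nonneg_left (exp_le_exp.2 ?_) (exp_pos _).le)
    (by positivity) (by norm_num)
  have : (0 : ℝ) ≤ s * u := mul_nonneg hs (zero_le_one.trans (le_of_lt hu))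
  linarith

lemma hankelArc_expPow_succ (c s L : ℝ) :
    c * hankelArc c (expPow s) L - s * hankelArc c (expPow (s + 1)) L =
      Complex.exp (-(c * rexp L : ℝ)) *
        (expPow s (L + π * Complex.I) - expPow s (L + (-π : ℝ) * Complex.I)) := by
  have hi (r : ℝ) : IntervalIntegrable
      (fun φ : ℝ => hankelKernel c (expPow r) (L + φ * Complex.I)) volume (-π) π :=
    (continuousOn_hankelKernel_vertical (differentiableOn_expPow r) L).intervalIntegrable
  have hF (φ : ℝ) (_ : φ ∈ uIcc (-π) π) : HasDerivAt
      (fun φ : ℝ => Complex.exp (c * Complex.exp (L + φ * Complex.I)) *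
        expPow s (L + φ * Complex.I))
      (c * Complex.I * hankelKernel c (expPow s) (L + φ * Complex.I) -
        s * Complex.I * hankelKernel c (expPow (s + 1)) (L + φ * Complex.I)) φ := by
    have h0 : HasDerivAt (fun φ : ℝ => (L + φ * Complex.I : ℂ)) Complex.I φ := by
      simpa using ((Complex.ofRealCLM.hasDerivAt (x := φ)).mul_const Complex.I).const_add (L : ℂ)
    have h1 := ((h0.cexp.const_mul (c : ℂ)).cexp).mul ((h0.const_mul (s : ℂ)).neg.cexp)
    convert! h1 using 1
    set w : ℂ := L + φ * Complex.I
    have h2 : Complex.exp w * expPow (s + 1) w = Complex.exp (-(s * w)) := by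
      rw [expPow, ← Complex.exp_add]; push_cast; ring_nf
    rw [hankelKernel, hankelKernel, mul_assoc _ _ (expPow (s + 1) w), h2, expPow]
    simp only [Pi.neg_apply]
    ring
  have h := intervalIntegral.integral_eq_sub_of_hasDerivAt hF
    (((hi s).const_mul _).sub ((hi (s + 1)).const_mul _))
  rw [intervalIntegral.integral_sub ((hi s).const_mul _) ((hi (s + 1)).const_mul _),
    intervalIntegral.integral_const_mul, intervalIntegral.integral_const_mul,
    exp_add_pi_mul_I, exp_add_neg_pi_mul_I] at h
  rw [hankelArc, hankelArc]
  push_cast at h ⊢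
  rw [← mul_neg]
  linear_combination h

lemma norm_expPow (s : ℝ) (L φ : ℝ) :
    ‖expPow s (L + φ * Complex.I)‖ = rexp (-(s * L)) := by
  simp [expPow, Complex.norm_exp]

lemma hankelIntegral_expPow_succ {c s : ℝ} (hc : 0 < c) (hs : 0 ≤ s) :
    c * hankelIntegral c (expPow s) = s * hankelIntegral c (expPow (s + 1)) := by
  have h1 := (tendsto_hankelArc_atTop (differentiableOn_expPow s)
    (integrableOn_hankelJump_expPow hc hs)).const_mul (c : ℂ)
  have h2 := (tendsto_hankelArc_atTop (differentiableOn_expPow (s + 1))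
    (integrableOn_hankelJump_expPow hc (by linarith))).const_mul (s : ℂ)
  refine sub_eq_zero.1 (tendsto_nhds_unique (h1.sub h2) ?_)
  simp only [hankelArc_expPow_succ]
  have h3 : Tendsto (fun L => rexp (-(c * rexp L)) * 2) atTop (𝓝 0) := by
    simpa using (tendsto_exp_neg_atTop_nhds_zero.comp
      (tendsto_exp_atTop.const_mul_atTop hc)).mul_const 2
  refine squeeze_zero_norm' ?_ h3
  filter_upwards [eventually_ge_atTop 0] with L hL
  rw [norm_mul, Complex.norm_exp]
  simp only [Complex.neg_re, Complex.ofReal_re]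
  refine mul_le_mul_of_nonneg_left ((norm_sub_le _ _).trans ?_) (exp_pos _).le
  rw [norm_expPow, norm_expPow]
  have : rexp (-(s * L)) ≤ 1 := exp_le_one_iff.2 (by nlinarith)
  linarith

lemma norm_exp_mul_expPow (s : ℝ) (L φ : ℝ) :
    ‖Complex.exp (L + φ * Complex.I) * expPow s (L + φ * Complex.I)‖ = rexp ((1 - s) * L) := by
  rw [norm_mul, norm_expPow, Complex.norm_exp, ← exp_add]
  simp only [Complex.add_re, Complex.ofReal_re, Complex.re_ofReal_mul, Complex.I_re]
  ring_nf

lemma hankelIntegral_expPow_of_lt_one {c s : ℝ} (hc : 0 < c) (hs0 : 0 < s) (hs : s < 1) :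
    hankelIntegral c (expPow s) = 2 * π * Complex.I * (c ^ (s - 1) / Real.Gamma s : ℝ) := by
  have hs' : 0 < 1 - s := sub_pos.2 hs
  have hl := tendsto_hankelArc_atBot (c := c) (M := 1) (l := 0) (differentiableOn_expPow s)
    (by
      filter_upwards [eventually_le_atBot 0] with L hL φ
      rw [norm_exp_mul_expPow]
      exact exp_le_one_iff.2 (mul_nonpos_of_nonneg_of_nonpos hs'.le hL))
    (fun φ => by
      rw [tendsto_zero_iff_norm_tendsto_zero]
      simp only [norm_exp_mul_expPow]
      exact tendsto_exp_atBot.comp (tendsto_id.const_mul_atBot hs'))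
  rw [hankelIntegral_eq_of_tendsto_atBot (differentiableOn_expPow s)
    (integrable_hankelJump_expPow hc hs) hl]
  simp only [hankelJump_expPow]
  rw [MeasureTheory.integral_const_mul, integral_complex_ofReal, integral_exp_neg_mul_exp hc hs']
  have hG := Real.Gamma_mul_Gamma_one_sub s
  have hsin : sin (π * s) ≠ 0 := (sin_pos_of_pos_of_lt_pi (by positivity)
    (by nlinarith [pi_pos])).ne'
  have hG0 := (Gamma_pos_of_pos hs0).ne'
  have e : sin (π * s) * ((1 / c) ^ (1 - s) * Real.Gamma (1 - s)) =
      π * (c ^ (s - 1) / Real.Gamma s) := by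
    rw [one_div, inv_rpow hc.le, ← rpow_neg hc.le, neg_sub]
    rw [eq_div_iff hsin] at hG
    field_simp
    linear_combination hG
  have e' := congrArg (fun x : ℝ => (x : ℂ)) e
  push_cast at e' ⊢
  linear_combination 2 * Complex.I * e'

lemma hankelIntegral_expPow_one (c : ℝ) :
    hankelIntegral c (expPow 1) = 2 * π * Complex.I := by
  have hw (w : ℂ) : Complex.exp w * expPow 1 w = 1 := by
    rw [expPow, ← Complex.exp_add]; simp
  have hl := tendsto_hankelArc_atBot (c := c) (M := 1) (l := 1) (differentiableOn_expPow 1)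
    (by simp [hw]) (by simp [hw])
  have hj : hankelJump c (expPow 1) = 0 := funext fun u => by simp [hankelJump_expPow]
  rw [hankelIntegral_eq_of_tendsto_atBot (differentiableOn_expPow 1)
    (by rw [hj]; exact integrable_zero _ _ _) hl, hj]
  simp

/-- Hankel's integral for the reciprocal Gamma function. -/
lemma hankelIntegral_expPow {c s : ℝ} (hc : 0 < c) (hs : 0 < s) :
    hankelIntegral c (expPow s) = 2 * π * Complex.I * (c ^ (s - 1) / Real.Gamma s : ℝ) := by
  suffices ∀ n : ℕ, ∀ s : ℝ, 0 < s → s ≤ n + 1 →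
      hankelIntegral c (expPow s) = 2 * π * Complex.I * (c ^ (s - 1) / Real.Gamma s : ℝ) by
    obtain ⟨n, hn⟩ := exists_nat_ge s
    exact this n s hs (by linarith)
  have base (s : ℝ) (hs : 0 < s) (h1 : s ≤ 1) :
      hankelIntegral c (expPow s) = 2 * π * Complex.I * (c ^ (s - 1) / Real.Gamma s : ℝ) := by
    rcases h1.lt_or_eq with h | rfl
    · exact hankelIntegral_expPow_of_lt_one hc hs h
    · simp [hankelIntegral_expPow_one c]
  intro n
  induction n with
  | zero => intro s hs h; exact base s hs (by simpa using h)
  | succ n ih =>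
    intro s hs h
    rcases le_or_gt s 1 with h1 | h1
    · exact base s hs h1
    have hs' : 0 < s - 1 := by linarith
    have h2 := hankelIntegral_expPow_succ hc hs'.le
    push_cast at h
    rw [ih (s - 1) hs' (by linarith), sub_add_cancel] at h2
    have hG := Real.Gamma_add_one hs'.ne'
    rw [sub_add_cancel] at hG
    have hG0 := (Gamma_pos_of_pos hs').ne'
    have e : c * (c ^ (s - 1 - 1) / Real.Gamma (s - 1)) =
        (s - 1) * (c ^ (s - 1) / Real.Gamma s) := by
      rw [hG, rpow_sub_one hc.ne']
      field_simp
    have e' := congrArg (fun x : ℝ => (x : ℂ)) e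
    have hs0 : ((s - 1 : ℝ) : ℂ) ≠ 0 := by exact_mod_cast hs'.ne'
    refine mul_left_cancel₀ hs0 ?_
    rw [← h2]
    push_cast at e' ⊢
    linear_combination 2 * π * Complex.I * e'

lemma hankelIntegral_const_mul (c : ℝ) (a : ℂ) (g : ℂ → ℂ) :
    hankelIntegral c (fun w => a * g w) = a * hankelIntegral c g := by
  have h (w : ℂ) : hankelKernel c (fun w => a * g w) w = a * hankelKernel c g w := by
    simp only [hankelKernel]; ring
  simp only [hankelIntegral, hankelArc, hankelJump, h, ← mul_sub,
    intervalIntegral.integral_const_mul, MeasureTheory.integral_const_mul]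
  ring

lemma hasSum_hankelIntegral {c : ℝ} (hc : 0 < c) {g : ℕ → ℂ → ℂ} {G : ℂ → ℂ} {b : ℕ → ℝ}
    (hg : ∀ k, DifferentiableOn ℂ (g k) logStrip) (hb : Summable b)
    (hgb : ∀ k, ∀ L φ : ℝ, 1 ≤ L → ‖g k (L + φ * Complex.I)‖ ≤ b k)
    (hG : ∀ L φ : ℝ, 1 ≤ L →
      HasSum (fun k => g k (L + φ * Complex.I)) (G (L + φ * Complex.I))) :
    HasSum (fun k => hankelIntegral c (g k)) (hankelIntegral c G) := by
  refine HasSum.add (HasSum.mul_left _ ?_) ?_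
  · refine intervalIntegral.hasSum_integral_of_dominated_convergence
      (fun k _ => rexp (c * rexp 1) * rexp 1 * b k)
      (fun k => aestronglyMeasurable_hankelKernel_vertical (hg k) 1)
      (fun k => Eventually.of_forall fun φ _ => ?_)
      (Eventually.of_forall fun _ _ => hb.mul_left _) (by simp)
      (Eventually.of_forall fun φ _ => (hG 1 φ le_rfl).mul_left _)
    rw [hankelKernel, norm_mul, norm_mul]
    have h1 : ‖Complex.exp ((1 : ℝ) + φ * Complex.I)‖ = rexp 1 := by simp [Complex.norm_exp]
    have h2 : ‖Complex.exp (c * Complex.exp ((1 : ℝ) + φ * Complex.I))‖ ≤ rexp (c * rexp 1) := by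
      refine (Complex.norm_exp_le_exp_norm _).trans_eq ?_
      rw [norm_mul, h1, Complex.norm_real, Real.norm_of_nonneg hc.le]
    rw [h1]
    gcongr
    exact hgb k 1 φ le_rfl
  · refine MeasureTheory.hasSum_integral_of_dominated_convergence
      (fun k u => rexp (-(c * rexp u)) * rexp (1 * u) * (2 * b k))
      (fun k => (continuous_hankelJump (hg k)).aestronglyMeasurable)
      (fun k => ?_) (Eventually.of_forall fun u => (hb.mul_left _).mul_left _) ?_ ?_
    · refine (ae_restrict_mem measurableSet_Ioi).mono fun u hu => ?_
      rw [hankelJump_eq, norm_mul, Complex.norm_real, one_mul,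
        Real.norm_of_nonneg (mul_pos (exp_pos _) (exp_pos _)).le]
      refine mul_le_mul_of_nonneg_left ((norm_sub_le _ _).trans ?_)
        (mul_pos (exp_pos _) (exp_pos _)).le
      rw [two_mul]
      exact add_le_add (hgb k u _ (le_of_lt hu)) (hgb k u _ (le_of_lt hu))
    · simp only [tsum_mul_left]
      exact (integrable_exp_neg_mul_exp hc one_pos).integrableOn.mul_const _
    · refine (ae_restrict_mem measurableSet_Ioi).mono fun u hu => ?_
      simp only [hankelJump_eq]
      exact ((hG u _ (le_of_lt hu)).sub (hG u _ (le_of_lt hu))).mul_left _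

/-- The function `(1 + z^α)⁻¹` in the logarithmic coordinate. -/
noncomputable def mittagSymbol (α : ℝ) (w : ℂ) : ℂ := (1 + Complex.exp (α * w))⁻¹

lemma one_add_exp_ne_zero {α : ℝ} (hα0 : 0 < α) (hα1 : α < 1) {w : ℂ} (hw : w ∈ logStrip) :
    1 + Complex.exp (α * w) ≠ 0 := by
  intro h
  have hre := congrArg Complex.re h
  have him := congrArg Complex.im h
  simp only [Complex.add_re, Complex.add_im, Complex.one_re, Complex.one_im, Complex.exp_re,
    Complex.exp_im, Complex.re_ofReal_mul, Complex.im_ofReal_mul, Complex.zero_re,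
    Complex.zero_im, zero_add, mul_eq_zero, (exp_pos _).ne', false_or] at hre him
  have hw' := abs_le.1 (show |w.im| ≤ π from hw)
  have h0 := (sin_eq_zero_iff_of_lt_of_lt (by nlinarith [pi_pos]) (by nlinarith [pi_pos])).1 him
  rw [h0, cos_zero] at hre
  linarith [exp_pos (α * w.re)]

lemma differentiableOn_mittagSymbol {α : ℝ} (hα0 : 0 < α) (hα1 : α < 1) :
    DifferentiableOn ℂ (mittagSymbol α) logStrip :=
  DifferentiableOn.inv (by fun_prop) fun _ hw => one_add_exp_ne_zero hα0 hα1 hw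

/-- The spectral density `r^α sin(απ) / (r^{2α} + 2 r^α cos(απ) + 1)` at `r = e^u`. -/
noncomputable def spectralDensity (α u : ℝ) : ℝ :=
  rexp (α * u) * sin (α * π) / (1 + 2 * rexp (α * u) * cos (α * π) + rexp (α * u) ^ 2)

lemma neg_one_lt_cos_mul_pi {α : ℝ} (hα0 : 0 < α) (hα1 : α < 1) : -1 < cos (α * π) := by
  rw [← cos_pi]
  exact cos_lt_cos_of_nonneg_of_le_pi (by positivity) le_rfl (by nlinarith [pi_pos])

lemma sin_mul_pi_pos {α : ℝ} (hα0 : 0 < α) (hα1 : α < 1) : 0 < sin (α * π) :=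
  sin_pos_of_pos_of_lt_pi (by positivity) (by nlinarith [pi_pos])

lemma spectralDensity_denom_ge {α : ℝ} (u : ℝ) :
    2 * rexp (α * u) * (1 + cos (α * π)) ≤
      1 + 2 * rexp (α * u) * cos (α * π) + rexp (α * u) ^ 2 := by
  nlinarith [sq_nonneg (1 - rexp (α * u))]

lemma spectralDensity_denom_pos {α : ℝ} (hα0 : 0 < α) (hα1 : α < 1) (u : ℝ) :
    0 < 1 + 2 * rexp (α * u) * cos (α * π) + rexp (α * u) ^ 2 :=
  lt_of_lt_of_le (mul_pos (by positivity) (by linarith [neg_one_lt_cos_mul_pi hα0 hα1]))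
    (spectralDensity_denom_ge u)

lemma abs_spectralDensity_le {α : ℝ} (hα0 : 0 < α) (hα1 : α < 1) (u : ℝ) :
    |spectralDensity α u| ≤ sin (α * π) / (2 * (1 + cos (α * π))) := by
  have h1 := neg_one_lt_cos_mul_pi hα0 hα1
  have h2 := sin_mul_pi_pos hα0 hα1
  have h3 := spectralDensity_denom_pos hα0 hα1 u
  rw [spectralDensity, abs_of_nonneg (by positivity), div_le_div_iff₀ h3 (by linarith)]
  nlinarith [mul_le_mul_of_nonneg_left (spectralDensity_denom_ge (α := α) u) h2.le]

lemma hankelJump_mittagSymbol {α : ℝ} (hα0 : 0 < α) (hα1 : α < 1) (c u : ℝ) :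
    hankelJump c (mittagSymbol α) u =
      2 * Complex.I * (rexp (-(c * rexp u)) * rexp u * spectralDensity α u : ℝ) := by
  have n1 := one_add_exp_ne_zero hα0 hα1
    (add_mul_I_mem_logStrip (u := u) (φ := π) (abs_of_pos pi_pos).le)
  have n2 := one_add_exp_ne_zero hα0 hα1
    (add_mul_I_mem_logStrip (u := u) (φ := -π) (by rw [abs_neg, abs_of_pos pi_pos]))
  have n3 : (1 + 2 * rexp (α * u) * cos (α * π) + rexp (α * u) ^ 2 : ℂ) ≠ 0 := by
    exact_mod_cast (spectralDensity_denom_pos hα0 hα1 u).ne'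
  have h1 : (α * (u + π * Complex.I) : ℂ) = (α * u : ℝ) + (α * π : ℝ) * Complex.I := by
    push_cast; ring
  have h2 : (α * (u + (-π : ℝ) * Complex.I) : ℂ) =
      (α * u : ℝ) + (-(α * π) : ℝ) * Complex.I := by
    push_cast; ring
  rw [h1, Complex.exp_add, Complex.exp_mul_I, ← Complex.ofReal_exp, ← Complex.ofReal_cos,
    ← Complex.ofReal_sin] at n1
  rw [h2, Complex.exp_add, Complex.exp_mul_I, ← Complex.ofReal_exp, ← Complex.ofReal_cos,
    ← Complex.ofReal_sin, cos_neg, sin_neg] at n2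
  rw [hankelJump_eq, mittagSymbol, mittagSymbol, h1, h2, Complex.exp_add, Complex.exp_add,
    Complex.exp_mul_I, Complex.exp_mul_I, ← Complex.ofReal_exp, ← Complex.ofReal_cos,
    ← Complex.ofReal_sin, ← Complex.ofReal_cos, ← Complex.ofReal_sin, cos_neg, sin_neg,
    spectralDensity]
  have hsc : (sin (α * π) : ℂ) ^ 2 + (cos (α * π) : ℂ) ^ 2 = 1 := by
    exact_mod_cast sin_sq_add_cos_sq (α * π)
  have hd : (1 + 2 * rexp (α * u) * cos (α * π) + rexp (α * u) ^ 2 : ℂ) =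
      (1 + rexp (α * u) * (cos (α * π) + sin (α * π) * Complex.I)) *
        (1 + rexp (α * u) * (cos (α * π) + (-sin (α * π) : ℝ) * Complex.I)) := by
    push_cast at hsc ⊢
    linear_combination (-Complex.exp (α * u) ^ 2) * hsc +
      Complex.exp (α * u) ^ 2 * Complex.sin (α * π) ^ 2 * Complex.I_sq
  rw [Complex.ofReal_mul _ (_ / _), Complex.ofReal_div]
  have hd' : ((1 + 2 * rexp (α * u) * cos (α * π) + rexp (α * u) ^ 2 : ℝ) : ℂ) =
      (1 + rexp (α * u) * (cos (α * π) + sin (α * π) * Complex.I)) *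
        (1 + rexp (α * u) * (cos (α * π) + (-sin (α * π) : ℝ) * Complex.I)) := by
    rw [← hd]; norm_cast
  rw [hd', inv_sub_inv n2 n1, mul_comm (1 + _ : ℂ)]
  push_cast
  ring

lemma integrable_hankelJump_mittagSymbol {α c : ℝ} (hα0 : 0 < α) (hα1 : α < 1) (hc : 0 < c) :
    Integrable (hankelJump c (mittagSymbol α)) := by
  refine ((integrable_exp_neg_mul_exp hc one_pos).mul_const
    (2 * (sin (α * π) / (2 * (1 + cos (α * π)))))).mono'
    (continuous_hankelJump (differentiableOn_mittagSymbol hα0 hα1)).aestronglyMeasurable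
    (Eventually.of_forall fun u => ?_)
  have h : ‖hankelJump c (mittagSymbol α) u‖ =
      rexp (-(c * rexp u)) * rexp (1 * u) * (2 * |spectralDensity α u|) := by
    rw [hankelJump_mittagSymbol hα0 hα1, norm_mul, Complex.norm_real, norm_mul, norm_mul,
      Real.norm_eq_abs, Real.norm_eq_abs, abs_of_pos (mul_pos (exp_pos _) (exp_pos _)), one_mul,
      Complex.norm_I, Complex.norm_ofNat]
    ring
  rw [h]
  gcongr
  exact abs_spectralDensity_le hα0 hα1 u

lemma hankelIntegral_mittagSymbol {α c : ℝ} (hα0 : 0 < α) (hα1 : α < 1) (hc : 0 < c) :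
    hankelIntegral c (mittagSymbol α) = 2 * Complex.I *
      (∫ u, rexp (-(c * rexp u)) * rexp u * spectralDensity α u : ℝ) := by
  have hexp (φ : ℝ) {a : ℝ} (ha : 0 < a) :
      Tendsto (fun L : ℝ => Complex.exp (a * (L + φ * Complex.I))) atBot (𝓝 0) := by
    rw [tendsto_zero_iff_norm_tendsto_zero]
    simp only [Complex.norm_exp]
    refine (tendsto_exp_atBot.comp (tendsto_id.const_mul_atBot ha)).congr fun L => ?_
    simp
  have hl := tendsto_hankelArc_atBot (c := c) (M := 2) (l := 0)
    (differentiableOn_mittagSymbol hα0 hα1)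
    (by
      have h0 : ∀ᶠ L : ℝ in atBot, rexp (α * L) < 1 / 2 :=
        (tendsto_exp_atBot.comp (tendsto_id.const_mul_atBot hα0)).eventually_lt_const
          (by norm_num)
      filter_upwards [eventually_le_atBot 0, h0] with L hL h0 φ
      have h1 : ‖Complex.exp (L + φ * Complex.I)‖ ≤ 1 := by
        simpa [Complex.norm_exp] using hL
      have h2 : ‖Complex.exp (α * (L + φ * Complex.I))‖ < 1 / 2 := by
        simpa [Complex.norm_exp] using h0
      have h3 : 1 / 2 ≤ ‖1 + Complex.exp (α * (L + φ * Complex.I))‖ := by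
        have := norm_sub_le_norm_add (1 : ℂ) (Complex.exp (α * (L + φ * Complex.I)))
        rw [norm_one] at this
        linarith
      rw [norm_mul, mittagSymbol, norm_inv]
      have h4 : ‖1 + Complex.exp (α * (L + φ * Complex.I))‖⁻¹ ≤ 2 := by
        simpa using inv_anti₀ (by norm_num) h3
      nlinarith [norm_nonneg (Complex.exp (L + φ * Complex.I))])
    (fun φ => by
      have h1 := hexp φ one_pos
      have h2 := ((hexp φ hα0).const_add 1).inv₀ (by simp)
      simpa [mittagSymbol] using h1.mul h2)
  rw [hankelIntegral_eq_of_tendsto_atBot (differentiableOn_mittagSymbol hα0 hα1)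
    (integrable_hankelJump_mittagSymbol hα0 hα1 hc) hl]
  simp only [hankelJump_mittagSymbol hα0 hα1]
  rw [MeasureTheory.integral_const_mul, integral_complex_ofReal]
  ring

lemma expPow_mul_nat_succ (α : ℝ) (k : ℕ) (w : ℂ) :
    expPow (α * k + α) w = expPow α w ^ (k + 1) := by
  rw [expPow, expPow, ← Complex.exp_nat_mul]
  push_cast
  ring_nf

/-- The integral representation of `c^{α-1} E_{α,α}(-c^α)` as a Laplace transform. -/
lemma hasSum_integral_spectralDensity {α c : ℝ} (hα0 : 0 < α) (hα1 : α < 1) (hc : 0 < c) :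
    HasSum (fun k : ℕ => π * (c ^ (α - 1) * ((-(c ^ α)) ^ k / Real.Gamma (α * k + α))))
      (∫ u, rexp (-(c * rexp u)) * rexp u * spectralDensity α u) := by
  have hρ : rexp (-α) < 1 := exp_lt_one_iff.2 (by linarith)
  have hs := hasSum_hankelIntegral hc (G := mittagSymbol α)
    (g := fun (k : ℕ) w => (-1) ^ k * expPow (α * k + α) w) (b := fun k => rexp (-α) ^ k)
    (fun k => (differentiableOn_expPow _).const_mul _)
    (summable_geometric_of_lt_one (exp_pos _).le hρ)
    (fun k L φ hL => by
      rw [norm_mul, norm_expPow, norm_pow, norm_neg, norm_one, one_pow, one_mul, ← exp_nat_mul]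
      refine exp_le_exp.2 ?_
      have : 0 ≤ α * k := by positivity
      nlinarith)
    (fun L φ hL => by
      set w : ℂ := L + φ * Complex.I
      have hq : ‖-expPow α w‖ < 1 := by
        rw [norm_neg, norm_expPow]
        exact exp_lt_one_iff.2 (by nlinarith)
      have h := (hasSum_geometric_of_norm_lt_one hq).mul_left (expPow α w)
      have e : expPow α w * (1 - -expPow α w)⁻¹ = mittagSymbol α w := by
        have h1 : Complex.exp (α * w) = (expPow α w)⁻¹ := by
          rw [expPow, Complex.exp_neg, inv_inv]
        have h2 : expPow α w ≠ 0 := Complex.exp_ne_zero _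
        rw [mittagSymbol, h1, sub_neg_eq_add, ← div_eq_mul_inv, ← one_div_div, one_div, add_div,
          div_self h2, one_div, add_comm]
      rw [e] at h
      refine h.congr_fun fun k => ?_
      rw [expPow_mul_nat_succ, neg_pow, pow_succ]
      ring)
  simp only [hankelIntegral_const_mul, hankelIntegral_mittagSymbol hα0 hα1 hc] at hs
  have h2I : 2 * Complex.I ≠ 0 := by simp
  rw [← Complex.hasSum_ofReal, ← hasSum_mul_left_iff h2I]
  refine hs.congr_fun fun k => ?_
  have hk : 0 < α * k + α := by positivity
  have e : c ^ (α * k + α - 1) = c ^ (α - 1) * (c ^ α) ^ k := by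
    rw [← rpow_mul_natCast hc.le, ← rpow_add hc]
    ring_nf
  rw [hankelIntegral_expPow hc hk, e, neg_pow]
  push_cast
  ring

/-- For `0 < α < 1`, `t > 0`, `x ∈ ℝ²` nonzero and `c = |x|²/(4t)`, the subordinated
two-dimensional Green function equals `(1/(4πt)) c^{α-1} E_{α,α}(-c^α)`. -/
theorem green_2d_alpha (α t : ℝ) (hα0 : 0 < α) (hα1 : α < 1) (ht : 0 < t)
    (x : EuclideanSpace ℝ (Fin 2)) (hx : x ≠ 0) (c : ℝ) (hc : c = ‖x‖ ^ 2 / (4 * t)) :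
    (t ^ α / (4 * Real.pi ^ 2)) *
      ∫ τ in Set.Ioi (0 : ℝ),
        (τ ^ (α - 2) * Real.sin (α * Real.pi)) /
          (t ^ (2 * α) + 2 * t ^ α * τ ^ α * Real.cos (α * Real.pi) + τ ^ (2 * α)) *
          Real.exp (-‖x‖ ^ 2 / (4 * τ))
      = (1 / (4 * Real.pi * t)) * c ^ (α - 1) *
          ∑' k : ℕ, (-(c ^ α)) ^ k / Real.Gamma (α * k + α) := by
  have hc0 : 0 < c := by
    have := norm_pos_iff.2 hx
    rw [hc]; positivity
  have hs := (hasSum_integral_spectralDensity hα0 hα1 hc0).tsum_eq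
  rw [tsum_mul_left, tsum_mul_left] at hs
  rw [integral_Ioi_eq_integral_mul_exp ht (k := -1) (by norm_num)]
  have key (u : ℝ) : |-1 * (t * rexp (-1 * u))| *
      (((t * rexp (-1 * u)) ^ (α - 2) * Real.sin (α * Real.pi)) /
          (t ^ (2 * α) + 2 * t ^ α * (t * rexp (-1 * u)) ^ α * Real.cos (α * Real.pi) +
            (t * rexp (-1 * u)) ^ (2 * α)) *
          Real.exp (-‖x‖ ^ 2 / (4 * (t * rexp (-1 * u))))) =
      1 / (t ^ α * t) * (rexp (-(c * rexp u)) * rexp u * spectralDensity α u) := by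
    have h1 : (t * rexp (-1 * u)) ^ α = t ^ α * (rexp (α * u))⁻¹ := by
      rw [mul_rpow ht.le (exp_pos _).le, ← exp_mul, ← exp_neg]
      ring_nf
    have hτ : 0 < t * rexp (-1 * u) := by positivity
    have h2 : (t * rexp (-1 * u)) ^ (α - 2) =
        t ^ α * (rexp (α * u))⁻¹ / (t * (rexp u)⁻¹) ^ 2 := by
      rw [rpow_sub hτ, h1, rpow_two, neg_one_mul, exp_neg u]
    have h3 : (t * rexp (-1 * u)) ^ (2 * α) = (t ^ α * (rexp (α * u))⁻¹) ^ 2 := by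
      rw [mul_comm 2 α, rpow_mul hτ.le, h1, rpow_two]
    have h4 : t ^ (2 * α) = (t ^ α) ^ 2 := by rw [mul_comm 2 α, rpow_mul ht.le, rpow_two]
    have h5 : -‖x‖ ^ 2 / (4 * (t * rexp (-1 * u))) = -(c * rexp u) := by
      rw [hc, neg_one_mul, exp_neg]
      field_simp
    have h6 : |-1 * (t * rexp (-1 * u))| = t * (rexp u)⁻¹ := by
      rw [neg_one_mul, abs_neg, abs_of_pos hτ, neg_one_mul, exp_neg]
    have hd := (spectralDensity_denom_pos hα0 hα1 u).ne'
    have hA : t ^ α ≠ 0 := (rpow_pos_of_pos ht α).ne'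
    have hρ := (exp_pos (α * u)).ne'
    rw [h1, h2, h3, h4, h5, h6, spectralDensity]
    have h7 : (t ^ α) ^ 2 + 2 * t ^ α * (t ^ α * (rexp (α * u))⁻¹) * cos (α * π) +
        (t ^ α * (rexp (α * u))⁻¹) ^ 2 = (t ^ α) ^ 2 * ((rexp (α * u))⁻¹) ^ 2 *
        (1 + 2 * rexp (α * u) * cos (α * π) + rexp (α * u) ^ 2) := by
      field_simp
      ring
    rw [h7]
    field_simp
  simp only [key]
  rw [MeasureTheory.integral_const_mul, ← hs]
  have hA : t ^ α ≠ 0 := (rpow_pos_of_pos ht α).ne'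
  have hpi := pi_ne_zero
  field_simp
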